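/- arXiv:1402.4028 — 3 statements merged into one kernel-verified Lean document; each statement's English description precedes it below -/
import Mathlib

section
/- Let F be a field with |F| ≥ 2d−1 and let φ: {0,1,…,d} → F be any injection with φ(0)=0, φ(1)=1. Define the diverted tangent line ℓ'_t as the line through a(t)=(1,t,…,t^d) and b(t)=(0,1,φ(2)t,…,φ(d)t^{d−1}). Then any 2d−1 distinct diverted tangent lines ℓ'_{t₁},…,ℓ'_{t_{2d−1}} form a generator set with respect to hyperplanes in PG(d,F). -/
/-- The diverted tangent line `ℓ'_t` determined by an injection `φ`: the line through
`a(t) = (1, t, …, t^d)` and `b(t) = (0, 1, φ(2)t, …, φ(d)t^{d-1})`. -/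
def divertedTangent (F : Type*) [Field F] (d : ℕ) (φ : Fin (d + 1) → F) (t : F) :
    Submodule F (Fin (d + 1) → F) :=
  Submodule.span F
    {fun i : Fin (d + 1) => t ^ (i : ℕ), fun i : Fin (d + 1) => φ i * t ^ ((i : ℕ) - 1)}

open Polynomial in
/-- The determinant polynomial attached to two coefficient vectors cannot vanish at `2d-1` points
when the vectors have different lowest indices. -/
lemma det_contra {F : Type*} [Field F] (d : ℕ) (φ : Fin (d + 1) → F)
    (hφ : Function.Injective φ) (hφ0 : φ 0 = 0)
    (t : Fin (2 * d - 1) → F) (ht : Function.Injective t)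
    (f g : Fin (d + 1) → F) (i0 j0 : Fin (d + 1)) (hne : i0 ≠ j0)
    (hf0 : f i0 ≠ 0) (hg0 : g j0 ≠ 0)
    (hf : ∀ i < i0, f i = 0) (hg : ∀ j < j0, g j = 0)
    (h : ∀ k, (∑ i, f i * t k ^ (i : ℕ)) * (∑ j, g j * (φ j * t k ^ ((j : ℕ) - 1))) =
      (∑ i, f i * (φ i * t k ^ ((i : ℕ) - 1))) * (∑ j, g j * t k ^ (j : ℕ))) : False := by
  set P : F[X] := ∑ i : Fin (d + 1), ∑ j : Fin (d + 1),
    C (f i * g j * (φ j - φ i)) * X ^ ((i : ℕ) + (j : ℕ) - 1) with hP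
  have hd : 0 < d := by
    rcases Nat.eq_zero_or_pos d with rfl | h
    · exact absurd (Fin.ext (by have := i0.2; have := j0.2; omega)) hne
    · exact h
  have key : ∀ (s : F) (i j : Fin (d + 1)),
      s ^ (i : ℕ) * (φ j * s ^ ((j : ℕ) - 1)) = φ j * s ^ ((i : ℕ) + (j : ℕ) - 1) := by
    intro s i j
    by_cases hj : j = 0
    · subst hj; simp [hφ0]
    · have : 0 < (j : ℕ) := Nat.pos_of_ne_zero (fun h => hj (Fin.ext h))
      rw [Nat.add_sub_assoc this, pow_add]; ring
  have heval : ∀ k, P.eval (t k) = 0 := by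
    intro k
    have h' := h k
    rw [Finset.sum_mul_sum, Finset.sum_mul_sum, ← sub_eq_zero, ← Finset.sum_sub_distrib] at h'
    rw [hP, eval_finsetSum, ← h']
    refine Finset.sum_congr rfl fun i _ => ?_
    rw [eval_finsetSum, ← Finset.sum_sub_distrib]
    refine Finset.sum_congr rfl fun j _ => ?_
    simp only [eval_mul, eval_C, eval_pow, eval_X]
    have h1 := key (t k) i j
    have h2 := key (t k) j i
    rw [Nat.add_comm (j : ℕ)] at h2
    linear_combination (-(f i * g j)) * h1 + (f i * g j) * h2
  have hdeg : P.degree < ((2 * d - 1 : ℕ) : WithBot ℕ) := by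
    rw [hP]
    refine (degree_sum_le _ _).trans_lt ?_
    rw [Finset.sup_lt_iff (WithBot.bot_lt_coe _)]
    intro i _
    refine (degree_sum_le _ _).trans_lt ?_
    rw [Finset.sup_lt_iff (WithBot.bot_lt_coe _)]
    intro j _
    by_cases hij : i = j
    · subst hij; simp
    · refine (degree_C_mul_X_pow_le _ _).trans_lt ?_
      have : (i : ℕ) ≠ j := fun h => hij (Fin.ext h)
      have := i.2
      have := j.2
      exact_mod_cast (by omega : (i : ℕ) + j - 1 < 2 * d - 1)
  have hP0 : P = 0 := by
    classical
    by_contra hne0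
    have h1 : (Finset.univ.image t).card ≤ P.natDegree := by
      refine card_le_degree_of_subset_roots (p := P) ?_
      intro x hx
      simp only [Finset.image_val, Multiset.mem_dedup, Multiset.mem_map] at hx
      obtain ⟨k, _, rfl⟩ := hx
      exact (mem_roots hne0).2 (heval k)
    rw [Finset.card_image_of_injective _ ht, Finset.card_univ, Fintype.card_fin] at h1
    have := (natDegree_lt_iff_degree_lt hne0).2 hdeg
    omega
  have hc : P.coeff ((i0 : ℕ) + j0 - 1) = f i0 * g j0 * (φ j0 - φ i0) := by
    have hne' : (i0 : ℕ) ≠ j0 := fun h => hne (Fin.ext h)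
    rw [hP, finsetSum_coeff, Finset.sum_eq_single i0, finsetSum_coeff,
      Finset.sum_eq_single j0]
    · rw [coeff_C_mul, coeff_X_pow, if_pos rfl, mul_one]
    · intro j _ hj
      have hj' : (j : ℕ) ≠ j0 := fun h => hj (Fin.ext h)
      rw [coeff_C_mul, coeff_X_pow]
      split_ifs with hh
      · by_cases hij : i0 = j
        · subst hij; simp
        · have : (i0 : ℕ) ≠ j := fun h => hij (Fin.ext h)
          omega
      · simp
    · simp
    · intro i _ hi
      have hi' : (i : ℕ) ≠ i0 := fun h => hi (Fin.ext h)
      rw [finsetSum_coeff]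
      refine Finset.sum_eq_zero fun j _ => ?_
      rw [coeff_C_mul, coeff_X_pow]
      split_ifs with hh
      · by_cases hij : i = j
        · subst hij; simp
        · have : (i : ℕ) ≠ j := fun h => hij (Fin.ext h)
          rcases lt_or_gt_of_ne hi' with hlt | hgt
          · rw [hf i hlt]; simp
          · rw [hg j (Fin.lt_def.2 (by omega))]; simp
      · simp
    · simp
  rw [hP0, coeff_zero] at hc
  exact mul_ne_zero (mul_ne_zero hf0 hg0)
    (sub_ne_zero.2 fun h => hne (hφ h).symm) hc.symm

lemma exists_first {F : Type*} [Field F] (n : ℕ) (f : Fin n → F) (hf : f ≠ 0) :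
    ∃ i, f i ≠ 0 ∧ ∀ j < i, f j = 0 := by
  obtain ⟨i, hi⟩ := Function.ne_iff.1 hf
  obtain ⟨m, hm, hmin⟩ := WellFounded.has_min (wellFounded_lt (α := Fin n))
    {i | f i ≠ 0} ⟨i, hi⟩
  exact ⟨m, hm, fun j hj => by_contra fun h => hmin j h hj⟩

lemma dual_apply_sum {F : Type*} [Field F] (n : ℕ) (f : (Fin n → F) →ₗ[F] F) (v : Fin n → F) :
    f v = ∑ i, f (Pi.single i 1) * v i := by
  rw [LinearMap.pi_apply_eq_sum_univ f v]
  refine Finset.sum_congr rfl fun i _ => ?_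
  rw [smul_eq_mul, mul_comm]
  congr 2
  ext j
  simp [Pi.single_apply, eq_comm]

/-- If `|F| ≥ 2d - 1` and `φ : {0,…,d} → F` is any injection with `φ(0) = 0`, `φ(1) = 1`,
then any `2d - 1` distinct diverted tangent lines `ℓ'_t` form a generator set with
respect to hyperplanes in `PG(d,F)`. -/
theorem diverted_tangents_generator (F : Type*) [Field F] (d : ℕ)
    (hF : ((2 * d - 1 : ℕ) : Cardinal) ≤ Cardinal.mk F)
    (φ : Fin (d + 1) → F) (hφ : Function.Injective φ)
    (hφ0 : φ 0 = 0) (hφ1 : φ 1 = 1)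
    (t : Fin (2 * d - 1) → F) (ht : Function.Injective t) :
    ∀ Pl : Submodule F (Fin (d + 1) → F), Module.finrank F Pl = d →
      Submodule.span F
        (⋃ k : Fin (2 * d - 1),
          ((divertedTangent F d φ (t k) : Set (Fin (d + 1) → F)) ∩
            (Pl : Set (Fin (d + 1) → F)))) = Pl := by
  intro Pl hPl
  set W := Submodule.span F
        (⋃ k : Fin (2 * d - 1),
          ((divertedTangent F d φ (t k) : Set (Fin (d + 1) → F)) ∩
            (Pl : Set (Fin (d + 1) → F)))) with hW
  have hWle : W ≤ Pl := by
    rw [hW, Submodule.span_le]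
    exact Set.iUnion_subset fun k => Set.inter_subset_right
  refine le_antisymm hWle ?_
  by_contra hnot
  obtain ⟨x, hxP, hxW⟩ := SetLike.not_le_iff_exists.1 hnot
  obtain ⟨g, hgx, hgW⟩ := Submodule.exists_le_ker_of_notMem hxW
  have hlt : Pl < ⊤ := by
    rw [lt_top_iff_ne_top]
    rintro rfl
    rw [finrank_top] at hPl
    simp at hPl
  obtain ⟨f, hf0, hfP⟩ := Submodule.exists_le_ker_of_lt_top Pl hlt
  have hker : Pl = LinearMap.ker f := by
    refine Submodule.eq_of_le_of_finrank_eq hfP ?_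
    have := Module.Dual.finrank_ker_add_one_of_ne_zero (f := f) hf0
    rw [Module.finrank_fin_fun] at this
    omega
  have hfx : f x = 0 := by simpa using hfP hxP
  have hfc : (fun i => f (Pi.single i 1)) ≠ 0 := by
    intro h0
    apply hf0
    ext i
    simpa using congrFun h0 i
  obtain ⟨i0, hi0, himin⟩ := exists_first _ _ hfc
  set g' : (Fin (d + 1) → F) →ₗ[F] F :=
    g - (g (Pi.single i0 1) / f (Pi.single i0 1)) • f with hg'
  have hg'x : g' x ≠ 0 := by simpa [hg', hfx] using hgx
  have hg'i : g' (Pi.single i0 1) = 0 := by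
    simp only [hg', LinearMap.sub_apply, LinearMap.smul_apply, smul_eq_mul]
    rw [div_mul_cancel₀ _ hi0, sub_self]
  have hgc : (fun i => g' (Pi.single i 1)) ≠ 0 := by
    intro h0
    apply hg'x
    rw [dual_apply_sum]
    exact Finset.sum_eq_zero fun i _ => by rw [show g' (Pi.single i 1) = 0 from congrFun h0 i, zero_mul]
  obtain ⟨j0, hj0, hjmin⟩ := exists_first _ _ hgc
  refine det_contra d φ hφ hφ0 t ht _ _ i0 j0 ?_ hi0 hj0 himin hjmin ?_
  · rintro rfl
    exact hj0 hg'i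
  · intro k
    set a : Fin (d + 1) → F := fun i => t k ^ (i : ℕ) with ha
    set b : Fin (d + 1) → F := fun i => φ i * t k ^ ((i : ℕ) - 1) with hb
    have hfa := dual_apply_sum _ f a
    have hfb := dual_apply_sum _ f b
    have hga := dual_apply_sum _ g' a
    have hgb := dual_apply_sum _ g' b
    have hvP : f b • a - f a • b ∈ Pl := by
      rw [hker, LinearMap.mem_ker]
      simp [mul_comm]
    have hvL : f b • a - f a • b ∈ divertedTangent F d φ (t k) :=
      Submodule.sub_mem _
        (Submodule.smul_mem _ _ (Submodule.subset_span (Set.mem_insert _ _)))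
        (Submodule.smul_mem _ _ (Submodule.subset_span (Set.mem_insert_of_mem _ rfl)))
    have hvW : f b • a - f a • b ∈ W :=
      Submodule.subset_span (Set.mem_iUnion.2 ⟨k, hvL, hvP⟩)
    have h1 : g (f b • a - f a • b) = 0 := by simpa using hgW hvW
    have h2 : f (f b • a - f a • b) = 0 := by simpa using hfP hvP
    have h3 : g' (f b • a - f a • b) = 0 := by
      rw [hg', LinearMap.sub_apply, LinearMap.smul_apply, h1, h2]; simp
    rw [map_sub, map_smul, map_smul, smul_eq_mul, smul_eq_mul] at h3
    change (∑ i, f (Pi.single i 1) * a i) * (∑ i, g' (Pi.single i 1) * b i) =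
      (∑ i, f (Pi.single i 1) * b i) * (∑ i, g' (Pi.single i 1) * a i)
    rw [← hfa, ← hfb, ← hga, ← hgb]
    linear_combination -h3
end

section
/- Over an algebraically closed field F, if a set L of lines in PG(d,F) has at most 2d−2 elements, then there exists a codimension-two subspace H of PG(d,F) meeting every line of L; consequently L is not a generator set with respect to hyperplanes. -/
namespace FewLines
open MvPolynomial

lemma homComp_mul {F ι : Type*} [Field F] (l a : MvPolynomial ι F) (hl : l.IsHomogeneous 1) (n : ℕ) :
    homogeneousComponent (n + 1) (a * l) = homogeneousComponent n a * l := by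
  induction a using MvPolynomial.induction_on' with
  | monomial d c =>
    have h1 : (monomial d c).IsHomogeneous d.degree := isHomogeneous_monomial c rfl
    rw [homogeneousComponent_of_mem h1, homogeneousComponent_of_mem (h1.mul hl)]
    by_cases h : n = d.degree <;> simp [h]
  | add p q hp hq => simp [add_mul, hp, hq]

lemma aeval_homComp {F ι κ : Type*} [Field F] (g : ι → MvPolynomial κ F)
    (hg : ∀ i, (g i).IsHomogeneous 2) (s : MvPolynomial ι F) (n : ℕ) :
    aeval g (homogeneousComponent n s) = homogeneousComponent (2 * n) (aeval g s) := by
  induction s using MvPolynomial.induction_on' with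
  | monomial d c =>
    have h1 : (monomial d c).IsHomogeneous d.degree := isHomogeneous_monomial c rfl
    rw [homogeneousComponent_of_mem h1, homogeneousComponent_of_mem (h1.aeval g hg)]
    by_cases h : n = d.degree <;> simp [h]
  | add p q hp hq => rw [map_add, map_add, hp, hq, map_add, map_add]

lemma integral_of_radical {F ι K A : Type*} [Field F] [Finite ι] [Fintype K] [CommRing A]
    [Algebra F A] (ψ : MvPolynomial ι F →ₐ[F] A) (hψ : Function.Surjective ψ)
    (hker : ∀ s, ψ s = 0 → ∀ n, ψ (homogeneousComponent n s) = 0)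
    (L : K → MvPolynomial ι F) (hL : ∀ k, (L k).IsHomogeneous 1)
    (h : ∀ i, (X i : MvPolynomial ι F) ∈
      (RingHom.ker ψ ⊔ Ideal.span (Set.range L)).radical) :
    Algebra.IsIntegral (Algebra.adjoin F (Set.range (fun k => ψ (L k)))) A := by
  classical
  set B := Algebra.adjoin F (Set.range (fun k => ψ (L k))) with hB
  set J := RingHom.ker ψ ⊔ Ideal.span (Set.range L) with hJ
  have hle : idealOfVars ι F ≤ J.radical := by
    rw [idealOfVars, Ideal.span_le]
    rintro _ ⟨i, rfl⟩
    exact h i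
  obtain ⟨N, hN⟩ := Ideal.exists_pow_le_of_le_radical_of_fg hle (idealOfVars_fg ι F)
  let M : Submodule B A := Submodule.span B
    ((fun m : ι →₀ ℕ => ψ (monomial m 1)) '' {m | m.degree ≤ N})
  have hFG : M.FG := Submodule.fg_span ((Finsupp.finite_of_degree_le N).image _)
  have key : ∀ n, ∀ s : MvPolynomial ι F, s.IsHomogeneous n → ψ s ∈ M := by
    intro n
    induction n with
    | zero =>
      intro s hs
      have : s = C (coeff 0 s) := by
        rw [← homogeneousComponent_zero, homogeneousComponent_eq_self hs]
      rw [this, ← algebraMap_eq, AlgHom.commutes]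
      have h1 : (1 : A) ∈ M := Submodule.subset_span ⟨0, by simp, by simp⟩
      have := M.smul_mem (algebraMap F B (coeff 0 s)) h1
      rwa [Algebra.smul_def, mul_one] at this
    | succ n ih =>
      intro s hs
      by_cases hn : n + 1 ≤ N
      · rw [s.as_sum, map_sum]
        refine Submodule.sum_mem _ fun m hm => ?_
        have hm' : m.degree = n + 1 := by
          have := hs (mem_support_iff.1 hm)
          rwa [Finsupp.degree_eq_weight_one]
        have h1 : ψ (monomial m 1) ∈ M :=
          Submodule.subset_span ⟨m, by simp [hm', hn], rfl⟩
        have := M.smul_mem (algebraMap F B (coeff m s)) h1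
        have e : monomial m (coeff m s) = coeff m s • monomial m (1 : F) := by
          simp [smul_monomial]
        rw [e, map_smul]
        rwa [algebraMap_smul] at this
      · have hsJ : s ∈ J := by
          apply hN
          rw [mem_pow_idealOfVars_iff]
          intro m hm
          have := hs (mem_support_iff.1 hm)
          change N ≤ m.degree
          have h2 : m.degree = n + 1 := by rwa [Finsupp.degree_eq_weight_one]
          omega
        obtain ⟨a, ha, b, hb, rfl⟩ := Submodule.mem_sup.1 hsJ
        obtain ⟨c, rfl⟩ := Ideal.mem_span_range_iff_exists_fun.1 hb
        rw [← homogeneousComponent_eq_self hs, map_add, map_add, hker a ha, zero_add,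
          map_sum, map_sum]
        refine Submodule.sum_mem _ fun k _ => ?_
        rw [homComp_mul _ _ (hL k), map_mul, mul_comm]
        exact M.smul_mem (⟨ψ (L k), Algebra.subset_adjoin ⟨k, rfl⟩⟩ : B)
          (ih _ (homogeneousComponent_isHomogeneous _ _))
  have htop : M = ⊤ := by
    rw [eq_top_iff]
    intro x _
    obtain ⟨s, rfl⟩ := hψ x
    rw [← sum_homogeneousComponent s, map_sum]
    exact Submodule.sum_mem _ fun n _ => key n _ (homogeneousComponent_isHomogeneous _ _)
  have : Module.Finite B A := ⟨htop ▸ hFG⟩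
  infer_instance

/-- Plücker coordinates -/
noncomputable def pl (F : Type*) [Field F] (n : ℕ) (p : Fin n × Fin n) :
    MvPolynomial (Fin n ⊕ Fin n) F :=
  X (Sum.inl p.1) * X (Sum.inr p.2) - X (Sum.inl p.2) * X (Sum.inr p.1)

lemma pl_hom (F : Type*) [Field F] (n : ℕ) (p : Fin n × Fin n) : (pl F n p).IsHomogeneous 2 :=
  ((isHomogeneous_X _ _).mul (isHomogeneous_X _ _)).sub
    ((isHomogeneous_X _ _).mul (isHomogeneous_X _ _))

/-- index of algebraically independent coordinates -/
def idx (n : ℕ) : Option (Fin n ⊕ Fin n) → Fin (n + 2) × Fin (n + 2)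
  | none => (0, 1)
  | some (Sum.inl j) => (0, j.succ.succ)
  | some (Sum.inr j) => (1, j.succ.succ)

lemma pl_indep (F : Type*) [Field F] (n : ℕ) :
    AlgebraicIndependent F (fun t => pl F (n + 2) (idx n t)) := by
  let P := MvPolynomial (Option (Fin n ⊕ Fin n)) F
  let Q := FractionRing P
  let ξ : Option (Fin n ⊕ Fin n) → Q := fun t => algebraMap P Q (X t)
  have hξ : AlgebraicIndependent F ξ := by
    have := (algebraicIndependent_X (Option (Fin n ⊕ Fin n)) F).map'
      (f := IsScalarTower.toAlgHom F P Q) (IsFractionRing.injective P Q)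
    exact this
  have h0 : ξ none ≠ 0 := hξ.ne_zero none
  let f : Fin (n + 2) → Q := Fin.cons 1 (Fin.cons 0 fun j => - ξ (some (Sum.inr j)) / ξ none)
  let g : Fin (n + 2) → Q := Fin.cons 0 (Fin.cons (ξ none) fun j => ξ (some (Sum.inl j)))
  refine AlgebraicIndependent.of_comp (aeval (Sum.elim f g)) ?_
  convert hξ using 1
  funext t
  have e1 : f 1 = 0 := rfl
  have e2 : g 1 = ξ none := rfl
  have e3 : f 0 = 1 := rfl
  have e4 : g 0 = 0 := rfl
  have e5 : ∀ j : Fin n, f j.succ.succ = - ξ (some (Sum.inr j)) / ξ none := fun _ => rfl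
  have e6 : ∀ j : Fin n, g j.succ.succ = ξ (some (Sum.inl j)) := fun _ => rfl
  rcases t with _ | j | j
  · simp [pl, idx, e1, e2, e3, e4, e5, e6]
  · simp [pl, idx, e1, e2, e3, e4, e5, e6]
  · simp [pl, idx, e1, e2, e3, e4, e5, e6, div_mul_cancel₀ _ h0]

/-- linear form of a line -/
noncomputable def lf {F : Type*} [Field F] {n : ℕ} (u v : Fin n → F) :
    MvPolynomial (Fin n × Fin n) F :=
  ∑ i, ∑ j, C (u i * v j) * X (i, j)

lemma lf_hom {F : Type*} [Field F] {n : ℕ} (u v : Fin n → F) : (lf u v).IsHomogeneous 1 :=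
  IsHomogeneous.sum _ _ _ fun _ _ => IsHomogeneous.sum _ _ _ fun _ _ =>
    (isHomogeneous_X _ _).C_mul _

theorem exists_point {F K : Type*} [Field F] [IsAlgClosed F] [Fintype K] (n : ℕ)
    (hK : Fintype.card K ≤ 2 * n) (u v : K → Fin (n + 2) → F) :
    ∃ f g : Fin (n + 2) → F, ∃ a b, f a = 0 ∧ g b = 0 ∧ f b ≠ 0 ∧ g a ≠ 0 ∧
      ∀ k, (∑ i, u k i * f i) * (∑ i, v k i * g i) = (∑ i, v k i * f i) * (∑ i, u k i * g i) := by
  classical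
  let ψ₀ : MvPolynomial (Fin (n + 2) × Fin (n + 2)) F →ₐ[F] _ := aeval (pl F (n + 2))
  let ψ := ψ₀.rangeRestrict
  have hψ0 : ∀ s, ψ s = 0 ↔ ψ₀ s = 0 := fun s => by
    rw [← Subtype.coe_inj]; rfl
  let J := RingHom.ker ψ ⊔ Ideal.span (Set.range fun k => lf (u k) (v k))
  by_cases hall : ∀ q ∈ zeroLocus F J, q = 0
  · exfalso
    have hint := integral_of_radical ψ ψ₀.rangeRestrict_surjective
      (fun s hs m => by
        rw [hψ0] at hs ⊢
        change aeval _ _ = 0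
        rw [aeval_homComp _ (pl_hom F (n + 2))]
        change homogeneousComponent _ (ψ₀ s) = 0
        rw [hs, map_zero])
      (fun k => lf (u k) (v k)) (fun k => lf_hom _ _) (fun i => by
        rw [← vanishingIdeal_zeroLocus_eq_radical (K := F), mem_vanishingIdeal_iff]
        intro x hx
        simp [hall x hx])
    have halg := @Algebra.IsIntegral.isAlgebraic _ _ _ _ _ _ hint
    have h1 : Algebra.trdeg F ψ₀.range ≤ _ := 
      Algebra.IsAlgebraic.trdeg_le_cardinalMk F (alg := halg) (Set.range fun k => ψ (lf (u k) (v k)))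
    have hind : AlgebraicIndependent F (fun t => ψ (X (idx n t))) := by
      refine AlgebraicIndependent.of_comp ψ₀.range.val ?_
      convert pl_indep F n using 1
      funext t
      change ψ₀ _ = _
      simp [ψ₀]
    have h2 := hind.lift_cardinalMk_le_trdeg
    have h4 : Cardinal.mk (Set.range fun k => ψ (lf (u k) (v k))) ≤ (2 * n : ℕ) := by
      rw [Cardinal.mk_fintype]
      exact_mod_cast (Fintype.card_range_le _).trans hK
    simp only [Cardinal.mk_fintype, Fintype.card_option, Fintype.card_sum, Fintype.card_fin,
      Cardinal.lift_natCast, Cardinal.lift_id] at h2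
    have h5 : ((n + n + 1 : ℕ) : Cardinal) ≤ ((2 * n : ℕ) : Cardinal) := by
      refine le_trans (by simpa using h2) (h1.trans h4)
    have := Nat.cast_le.1 h5
    omega
  · push Not at hall
    obtain ⟨q, hq, hne⟩ := hall
    obtain ⟨⟨a, b⟩, hab⟩ := Function.ne_iff.1 hne
    have hrel : ∀ s, ψ₀ s = 0 → aeval q s = 0 := fun s hs =>
      hq s (Ideal.mem_sup_left ((hψ0 s).2 hs))
    have haa : ∀ i, q (i, i) = 0 := fun i => by
      have := hrel (X (i, i)) (by simp [ψ₀, pl])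
      simpa using this
    have hanti : ∀ i j, q (i, j) = - q (j, i) := fun i j => by
      have := hrel (X (i, j) + X (j, i)) (by simp [ψ₀, pl])
      simp at this
      linear_combination this
    have hpl : ∀ i j, q (a, i) * q (b, j) - q (a, j) * q (b, i) = q (a, b) * q (i, j) :=
      fun i j => by
      have := hrel (X (a, i) * X (b, j) - X (a, j) * X (b, i) - X (a, b) * X (i, j))
        (by simp [ψ₀, pl]; ring)
      simp at this
      linear_combination this
    refine ⟨fun j => q (a, j), fun j => q (b, j), a, b, haa a, haa b, hab, ?_, ?_⟩
    · change q (b, a) ≠ 0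
      rw [hanti]
      exact neg_ne_zero.2 hab
    · intro k
      have hk := hq _ (Ideal.mem_sup_right (Ideal.subset_span ⟨k, rfl⟩))
      simp only [lf, map_sum, map_mul, aeval_C, aeval_X, Algebra.algebraMap_self,
        RingHom.id_apply] at hk
      rw [← sub_eq_zero, mul_comm (∑ i, v k i * _), Finset.sum_mul_sum, Finset.sum_mul_sum,
        ← Finset.sum_sub_distrib]
      have : q (a, b) * ∑ i, ∑ j, u k i * v k j * q (i, j) = 0 := by
        rw [hk, mul_zero]
      rw [← this, Finset.mul_sum]
      refine Finset.sum_congr rfl fun i _ => ?_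
      rw [← Finset.sum_sub_distrib, Finset.mul_sum]
      refine Finset.sum_congr rfl fun j _ => ?_
      linear_combination (u k i * v k j) * hpl i j

theorem exists_H {F : Type*} [Field F] [IsAlgClosed F] (n : ℕ)
    (L : Finset (Submodule F (Fin (n + 2) → F)))
    (hL : ∀ ℓ ∈ L, Module.finrank F ℓ = 2) (hcard : L.card ≤ 2 * n) :
    ∃ H : Submodule F (Fin (n + 2) → F),
        Module.finrank F H = n ∧ ∀ ℓ ∈ L, ℓ ⊓ H ≠ ⊥ := by
  let bs : ∀ k : L, Module.Basis (Fin 2) F k.1 := fun k =>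
    Module.finBasisOfFinrankEq F k.1 (hL k.1 k.2)
  obtain ⟨f, g, a, b, hfa, hgb, hfb, hga, h⟩ := exists_point (F := F) (K := L) n
    (by simpa using hcard) (fun k => (bs k 0).1) (fun k => (bs k 1).1)
  let φ : (Fin (n + 2) → F) →ₗ[F] F := ∑ i, f i • LinearMap.proj i
  let γ : (Fin (n + 2) → F) →ₗ[F] F := ∑ i, g i • LinearMap.proj i
  have hφ : ∀ w, φ w = ∑ i, w i * f i := fun w => by simp [φ, mul_comm]
  have hγ : ∀ w, γ w = ∑ i, w i * g i := fun w => by simp [γ, mul_comm]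
  refine ⟨LinearMap.ker (φ.prod γ), ?_, ?_⟩
  · have hs : LinearMap.range (φ.prod γ) = ⊤ := by
      rw [LinearMap.range_eq_top]
      rintro ⟨x, y⟩
      refine ⟨Pi.single b (x / f b) + Pi.single a (y / g a), ?_⟩
      have p1 : ∀ (i : Fin (n + 2)) (c : F), φ (Pi.single i c) = c * f i := fun i c => by
        rw [hφ, Finset.sum_eq_single i] <;> simp +contextual
      have p2 : ∀ (i : Fin (n + 2)) (c : F), γ (Pi.single i c) = c * g i := fun i c => by
        rw [hγ, Finset.sum_eq_single i] <;> simp +contextual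
      simp [p1, p2, hfa, hgb, hfb, hga]
    have := (φ.prod γ).finrank_range_add_finrank_ker
    rw [hs, finrank_top] at this
    simp at this
    omega
  · intro ℓ hℓ hbot
    have hk := h ⟨ℓ, hℓ⟩
    set B := bs ⟨ℓ, hℓ⟩ with hB
    rw [← hφ, ← hφ, ← hγ, ← hγ] at hk
    have key : ∀ x y : F, x * φ (B 0).1 + y * φ (B 1).1 = 0 →
        x * γ (B 0).1 + y * γ (B 1).1 = 0 → x = 0 ∧ y = 0 := by
      intro x y h1 h2
      have hm : ((x • B 0 + y • B 1 : ℓ) : Fin (n + 2) → F) ∈ ℓ ⊓ LinearMap.ker (φ.prod γ) := by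
        refine ⟨Subtype.mem _, ?_⟩
        simp [h1, h2]
      rw [hbot, Submodule.mem_bot, Submodule.coe_eq_zero] at hm
      have := Fintype.linearIndependent_iff.1 B.linearIndependent ![x, y] (by simpa using hm)
      exact ⟨this 0, this 1⟩
    have c1 := key (φ (B 1).1) (- φ (B 0).1) (by ring) (by linear_combination -hk)
    have c2 := key (γ (B 1).1) (- γ (B 0).1) (by linear_combination hk) (by ring)
    have := key 1 0 (by simpa using c1.2) (by simpa using c2.2)
    exact one_ne_zero this.1

theorem not_gen {F : Type*} [Field F] [Infinite F] (n : ℕ)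
    (L : Finset (Submodule F (Fin (n + 2) → F)))
    (hL : ∀ ℓ ∈ L, Module.finrank F ℓ = 2) (H : Submodule F (Fin (n + 2) → F))
    (hH : Module.finrank F H = n) (hmeet : ∀ ℓ ∈ L, ℓ ⊓ H ≠ ⊥) :
    ∃ Pl : Submodule F (Fin (n + 2) → F), Module.finrank F Pl = n + 1 ∧
      Submodule.span F
        (⋃ ℓ ∈ L, ((ℓ : Set (Fin (n + 2) → F)) ∩ (Pl : Set (Fin (n + 2) → F)))) ≠ Pl := by
  classical
  let s : Finset (Submodule F (Fin (n + 2) → F)) := insert H (L.image fun ℓ => H ⊔ ℓ)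
  have hs : ⊤ ∉ s := by
    intro ht
    rw [Finset.mem_insert, Finset.mem_image] at ht
    rcases ht with h | ⟨ℓ, hℓ, h⟩
    · rw [← h, finrank_top] at hH
      simp at hH
    · have h1 := Submodule.finrank_sup_add_finrank_inf_eq H ℓ
      rw [h, finrank_top, hH, hL ℓ hℓ] at h1
      simp at h1
      exact hmeet ℓ hℓ (by rw [inf_comm]; exact h1)
  have hne := Subspace.biUnion_ne_univ_of_top_notMem hs
  obtain ⟨w, hw⟩ := (Set.ne_univ_iff_exists_notMem _).1 hne
  simp only [Set.mem_iUnion, not_exists, SetLike.mem_coe] at hw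
  have hwH : w ∉ H := hw H (Finset.mem_insert_self _ _)
  have hwL : ∀ ℓ ∈ L, w ∉ H ⊔ ℓ := fun ℓ hℓ =>
    hw _ (Finset.mem_insert_of_mem (Finset.mem_image_of_mem _ hℓ))
  refine ⟨H ⊔ Submodule.span F {w}, ?_, ?_⟩
  · have hw0 : w ≠ 0 := fun h => hwH (h ▸ H.zero_mem)
    have h1 := Submodule.finrank_sup_add_finrank_inf_eq H (Submodule.span F {w})
    have h2 : H ⊓ Submodule.span F {w} = ⊥ :=
      ((Submodule.disjoint_span_singleton' hw0).2 hwH).eq_bot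
    rw [h2, finrank_bot, finrank_span_singleton hw0, hH] at h1
    exact h1
  · intro heq
    have hle : Submodule.span F (⋃ ℓ ∈ L, ((ℓ : Set (Fin (n + 2) → F)) ∩
        ((H ⊔ Submodule.span F {w} : Submodule F (Fin (n + 2) → F)) :
          Set (Fin (n + 2) → F)))) ≤ H := by
      rw [Submodule.span_le]
      intro x hx
      simp only [Set.mem_iUnion] at hx
      obtain ⟨ℓ, hℓ, hxℓ, hx⟩ := hx
      obtain ⟨y, hy, z, hz, rfl⟩ := Submodule.mem_sup.1 hx
      obtain ⟨c, rfl⟩ := Submodule.mem_span_singleton.1 hz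
      by_cases hc : c = 0
      · simpa [hc] using hy
      · exfalso
        apply hwL ℓ hℓ
        have e : w = c⁻¹ • ((y + c • w) - y) := by
          rw [add_sub_cancel_left, smul_smul, inv_mul_cancel₀ hc, one_smul]
        rw [e]
        exact Submodule.smul_mem _ _ (Submodule.sub_mem _ (Submodule.mem_sup_right hxℓ)
          (Submodule.mem_sup_left hy))
    rw [heq] at hle
    exact hwH (hle (Submodule.mem_sup_right (Submodule.mem_span_singleton_self w)))

end FewLines

/-- Over an algebraically closed field, any set of at most `2d - 2` lines of `PG(d,F)`
admits a codimension-two subspace meeting all of them; consequently it is not a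
generator set with respect to hyperplanes. -/
theorem few_lines_not_generator_algClosed (F : Type*) [Field F] [IsAlgClosed F]
    (d : ℕ) (hd : 1 ≤ d)
    (L : Finset (Submodule F (Fin (d + 1) → F)))
    (hL : ∀ ℓ ∈ L, Module.finrank F ℓ = 2)
    (hcard : L.card ≤ 2 * d - 2) :
    (∃ H : Submodule F (Fin (d + 1) → F),
        Module.finrank F H = d - 1 ∧ ∀ ℓ ∈ L, ℓ ⊓ H ≠ ⊥) ∧
      ¬ (∀ Pl : Submodule F (Fin (d + 1) → F), Module.finrank F Pl = d →
          Submodule.span F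
            (⋃ ℓ ∈ L, ((ℓ : Set (Fin (d + 1) → F)) ∩ (Pl : Set (Fin (d + 1) → F)))) = Pl) := by
  obtain ⟨n, rfl⟩ : ∃ n, d = n + 1 := ⟨d - 1, by omega⟩
  obtain ⟨H, hH, hmeet⟩ := FewLines.exists_H n L hL (by omega)
  refine ⟨⟨H, by simpa using hH, hmeet⟩, fun hall => ?_⟩
  have : Infinite F := inferInstance
  obtain ⟨Pl, hPl, hne⟩ := FewLines.not_gen n L hL H hH hmeet
  exact hne (hall Pl hPl)
end

section
/- Over an algebraically closed field F with the moment-curve setup available (|F| infinite), any 2d−1 distinct diverted tangent lines in PG(d,F) form a generator set of lines with respect to hyperplanes of minimal size; i.e., the minimal size of a higgledy-piggledy line set in PG(d,F) is exactly 2d−1. -/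
theorem exists_generic_valuation.{w} (F : Type w) [Field F] (e : ℕ) {κ : Type} [Fintype κ]
    (hκ : Fintype.card κ < 2 * e + 1) (a b : κ → Fin (e + 2) → F) :
    ∃ (E : Type w) (_ : Field E) (_ : Algebra F E) (V : ValuationSubring E)
      (U W : Fin (e + 2) → E), (∀ c : F, algebraMap F E c ∈ V) ∧
      (∀ k, (∑ i, algebraMap F E (a k i) * U i) * (∑ i, algebraMap F E (b k i) * W i)
        - (∑ i, algebraMap F E (b k i) * U i) * (∑ i, algebraMap F E (a k i) * W i) ∈ V) ∧
      ∃ i j, U i * W j - U j * W i ∉ V := by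
  classical
  let ι := Option (Fin e ⊕ Fin e)
  let E := FractionRing (MvPolynomial ι F)
  let X : ι → E := algebraMap (MvPolynomial ι F) E ∘ MvPolynomial.X
  have : Algebra.IsAlgebraic (MvPolynomial ι F) E :=
    IsLocalization.isAlgebraic E (nonZeroDivisors (MvPolynomial ι F))
  have hX : IsTranscendenceBasis F X :=
    (IsTranscendenceBasis.mvPolynomial ι F).algebraMap_comp
  let U : Fin (e + 2) → E := Fin.cons (X none) (Fin.cons 0 fun i => X (some (Sum.inl i)))
  let W : Fin (e + 2) → E := Fin.cons 0 (Fin.cons 1 fun i => X (some (Sum.inr i)))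
  let f : κ → E := fun k =>
    (∑ i, algebraMap F E (a k i) * U i) * (∑ i, algebraMap F E (b k i) * W i)
        - (∑ i, algebraMap F E (b k i) * U i) * (∑ i, algebraMap F E (a k i) * W i)
  let B := Algebra.adjoin F (Set.range f)
  let C := integralClosure B E
  have key : ∃ i j, U i * W j - U j * W i ∉ C := by
    by_contra! h
    have hs : IsAlgebraic B (X none) := by
      have := h 0 1
      have h2 : X none ∈ C := by simpa [U, W, Fin.cons_zero] using this
      exact IsIntegral.isAlgebraic h2
    have hne : X none ≠ 0 := hX.1.ne_zero none
    have halg : ∀ i, IsAlgebraic B (X i) := by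
      rintro (_ | i | i)
      · exact hs
      · have := h 1 i.succ.succ
        have h2 : X (some (Sum.inl i)) ∈ C := by
          have e1 : U 1 = 0 := rfl
          have e2 : W 1 = 1 := rfl
          have e3 : U i.succ.succ = X (some (Sum.inl i)) := rfl
          rw [e1, e2, e3] at this
          have h3 := neg_mem this
          rwa [zero_mul, mul_one, zero_sub, neg_neg] at h3
        exact IsIntegral.isAlgebraic h2
      · have := h 0 i.succ.succ
        have h2 : X none * X (some (Sum.inr i)) ∈ C := by
          have e1 : U 0 = X none := rfl
          have e2 : W 0 = 0 := rfl
          have e3 : W i.succ.succ = X (some (Sum.inr i)) := rfl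
          rw [e1, e2, e3] at this
          simpa using this
        have h3 := (IsIntegral.isAlgebraic h2).mul hs.inv
        have h4 : X none * X (some (Sum.inr i)) * (X none)⁻¹ = X (some (Sum.inr i)) := by
          rw [mul_comm, ← mul_assoc, inv_mul_cancel₀ hne, one_mul]
        rwa [h4] at h3
    have : Algebra.IsAlgebraic B E := hX.isAlgebraic_iff.2 halg
    have h1 := Algebra.IsAlgebraic.trdeg_le_cardinalMk F (Set.range f)
    have h2 := hX.1.lift_cardinalMk_le_trdeg
    have h3 : Cardinal.mk (Set.range f) ≤ Fintype.card κ := by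
      rw [Cardinal.mk_fintype]
      exact_mod_cast Fintype.card_range_le f
    have h4 := h1.trans h3
    have h5 : Algebra.trdeg F E < ((2 * e + 1 : ℕ) : Cardinal) :=
      h4.trans_lt (by exact_mod_cast hκ)
    have h6 : Fintype.card ι = 2 * e + 1 := by simp [ι]; ring
    rw [Cardinal.mk_fintype, h6] at h2
    simp only [Cardinal.lift_natCast, Cardinal.lift_id'] at h2
    exact absurd h2 (not_le.2 (by simpa using h5))
  obtain ⟨i, j, hij⟩ := key
  have : IsIntegrallyClosedIn C.toSubring E :=
    inferInstanceAs (IsIntegrallyClosedIn (integralClosure B E) E)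
  obtain ⟨V, hV, hn⟩ := Subring.exists_le_valuationSubring_of_isIntegrallyClosedIn
    (R := C.toSubring) (x := U i * W j - U j * W i) hij
  refine ⟨E, inferInstance, inferInstance, V, U, W, ?_, ?_, i, j, hn⟩
  · intro c
    exact hV (algebraMap_mem C (algebraMap F B c))
  · intro k
    exact hV (algebraMap_mem C (⟨f k, Algebra.subset_adjoin ⟨k, rfl⟩⟩ : B))


theorem diverted_det (F : Type*) [Field F] (d : ℕ) (hd : 1 ≤ d)
    (φ : Fin (d + 1) → F) (hφ : Function.Injective φ) (hφ0 : φ 0 = 0)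
    (t : Fin (2 * d - 1) → F) (ht : Function.Injective t)
    (u v : Fin (d + 1) → F) (m n : Fin (d + 1)) (hmn : m ≠ n)
    (hum : u m ≠ 0) (hvn : v n ≠ 0) (hu : ∀ i, m < i → u i = 0) (hv : ∀ i, n < i → v i = 0)
    (h : ∀ k, (∑ i : Fin (d + 1), t k ^ (i : ℕ) * u i) *
        (∑ i : Fin (d + 1), φ i * t k ^ ((i : ℕ) - 1) * v i) =
      (∑ i : Fin (d + 1), φ i * t k ^ ((i : ℕ) - 1) * u i) *
        (∑ i : Fin (d + 1), t k ^ (i : ℕ) * v i)) : False := by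
  classical
  let P : Polynomial F := ∑ i : Fin (d + 1), ∑ j : Fin (d + 1),
    Polynomial.C (u i * v j * (φ j - φ i)) * Polynomial.X ^ ((i : ℕ) + j - 1)
  have hφz : ∀ (i j : Fin (d + 1)) (s : F), φ j * (s ^ (i : ℕ) * s ^ ((j : ℕ) - 1)) =
      φ j * s ^ ((i : ℕ) + j - 1) := by
    intro i j s
    by_cases hj : j = 0
    · simp [hj, hφ0]
    · have : 0 < (j : ℕ) := Nat.pos_of_ne_zero fun h => hj (Fin.ext h)
      rw [← pow_add, Nat.add_sub_assoc this]
  have hev : ∀ k, P.eval (t k) = 0 := by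
    intro k
    have hk := sub_eq_zero.2 (h k)
    rw [← hk, Finset.sum_mul_sum, Finset.sum_mul_sum, ← Finset.sum_sub_distrib]
    simp only [P, Polynomial.eval_finsetSum]
    refine Finset.sum_congr rfl fun i _ => ?_
    rw [← Finset.sum_sub_distrib]
    refine Finset.sum_congr rfl fun j _ => ?_
    simp only [Polynomial.eval_mul, Polynomial.eval_C, Polynomial.eval_pow, Polynomial.eval_X]
    have h1 := hφz i j (t k)
    have h2 := hφz j i (t k)
    rw [add_comm (j : ℕ) i] at h2
    linear_combination - (u i * v j) * h1 + (u i * v j) * h2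
  have hdeg : P.natDegree < 2 * d - 1 := by
    have : P.natDegree ≤ 2 * d - 2 := by
      refine Polynomial.natDegree_sum_le_of_forall_le _ _ fun i _ => ?_
      refine Polynomial.natDegree_sum_le_of_forall_le _ _ fun j _ => ?_
      by_cases hij : i = j
      · simp [hij]
      · refine (Polynomial.natDegree_C_mul_X_pow_le _ _).trans ?_
        have : (i : ℕ) ≠ j := fun h => hij (Fin.ext h)
        omega
    omega
  have hP : P = 0 := Polynomial.eq_zero_of_natDegree_lt_card_of_eval_eq_zero P ht hev (by simpa)
  have hc : P.coeff ((m : ℕ) + n - 1) = u m * v n * (φ n - φ m) := by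
    have hmn' : (m : ℕ) ≠ n := fun h => hmn (Fin.ext h)
    simp only [P, Polynomial.finsetSum_coeff, Polynomial.coeff_C_mul_X_pow]
    have hz : ∀ i j : Fin (d + 1), (i ≠ m ∨ j ≠ n) →
      (if (m : ℕ) + n - 1 = i + j - 1 then u i * v j * (φ j - φ i) else 0) = 0 := by
      intro i j hij
      split_ifs with hh
      · by_cases h1 : m < i
        · simp [hu i h1]
        by_cases h2 : n < j
        · simp [hv j h2]
        by_cases h3 : i = j
        · simp [h3]
        exfalso
        rw [Fin.lt_def] at h1 h2
        have h3' : (i : ℕ) ≠ j := fun h => h3 (Fin.ext h)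
        have : (i : ℕ) ≠ m ∨ (j : ℕ) ≠ n := hij.imp (fun h h' => h (Fin.ext h')) (fun h h' => h (Fin.ext h'))
        omega
      · rfl
    rw [Finset.sum_eq_single m, Finset.sum_eq_single n]
    · simp
    · intro j _ hj; exact hz _ _ (Or.inr hj)
    · simp
    · intro i _ hi; exact Finset.sum_eq_zero fun j _ => hz _ _ (Or.inl hi)
    · simp
  rw [hP, Polynomial.coeff_zero] at hc
  have : φ n - φ m ≠ 0 := sub_ne_zero.2 fun h => hmn (hφ h).symm
  exact mul_ne_zero (mul_ne_zero hum hvn) this hc.symm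

theorem exists_top_index {F : Type*} [Field F] {d : ℕ} (u : Fin d → F) (hu : u ≠ 0) :
    ∃ m, u m ≠ 0 ∧ ∀ i, m < i → u i = 0 := by
  classical
  have : (Finset.univ.filter fun i => u i ≠ 0).Nonempty := by
    obtain ⟨i, hi⟩ := Function.ne_iff.1 hu
    exact ⟨i, by simpa using hi⟩
  obtain ⟨m, hm, hmax⟩ := Finset.exists_max_image _ id this
  refine ⟨m, by simpa using hm, fun i hi => ?_⟩
  by_contra h
  exact absurd (hmax i (by simpa using h)) (not_le.2 hi)

theorem diverted_generate (F : Type*) [Field F] (d : ℕ) (hd : 1 ≤ d)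
    (φ : Fin (d + 1) → F) (hφ : Function.Injective φ)
    (hφ0 : φ 0 = 0) 
    (t : Fin (2 * d - 1) → F) (ht : Function.Injective t)
    (Pl : Submodule F (Fin (d + 1) → F)) (hPl : Module.finrank F Pl = d) :
      Submodule.span F
        (⋃ k : Fin (2 * d - 1),
          ((divertedTangent F d φ (t k) : Set (Fin (d + 1) → F)) ∩
            (Pl : Set (Fin (d + 1) → F)))) = Pl := by
  classical
  set S := Submodule.span F
        (⋃ k : Fin (2 * d - 1),
          ((divertedTangent F d φ (t k) : Set (Fin (d + 1) → F)) ∩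
            (Pl : Set (Fin (d + 1) → F)))) with hS
  refine le_antisymm ?_ ?_
  · rw [hS, Submodule.span_le]
    exact Set.iUnion_subset fun k => Set.inter_subset_right
  by_contra hle
  obtain ⟨x, hxP, hxS⟩ := SetLike.not_le_iff_exists.1 hle
  have hlt : Pl < ⊤ := by
    refine lt_top_iff_ne_top.2 fun h => ?_
    rw [h, finrank_top] at hPl
    simp at hPl
  obtain ⟨f, hf0, hPf⟩ := Submodule.exists_le_ker_of_lt_top Pl hlt
  have hker : Pl = LinearMap.ker f := by
    refine Submodule.eq_of_le_of_finrank_eq hPf ?_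
    have := Module.Dual.finrank_ker_add_one_of_ne_zero (f := f) hf0
    simp at this
    omega
  obtain ⟨g, hgx, hSg⟩ := Submodule.exists_le_ker_of_notMem hxS
  have hfx : f x = 0 := hPf hxP
  have hrep : ∀ (f : (Fin (d + 1) → F) →ₗ[F] F) (y : Fin (d + 1) → F),
      f y = ∑ i, y i * f (Pi.single i 1) := by
    intro f y
    have := LinearMap.pi_apply_eq_sum_univ f y
    rw [this]
    refine Finset.sum_congr rfl fun i _ => ?_
    rw [smul_eq_mul]
    congr 2
    ext j
    simp [Pi.single_apply, eq_comm]
  have hdet : ∀ k y z, y ∈ divertedTangent F d φ (t k) → z ∈ divertedTangent F d φ (t k) →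
      f y * g z = f z * g y := by
    intro k y z hy hz
    have hmem : f y • z - f z • y ∈ S := by
      refine Submodule.subset_span (Set.mem_iUnion.2 ⟨k, ?_, ?_⟩)
      · exact sub_mem (Submodule.smul_mem _ _ hz) (Submodule.smul_mem _ _ hy)
      · rw [hker]
        simp [mul_comm]
    have := hSg hmem
    simpa [sub_eq_zero] using this
  have hu0 : (fun i => f (Pi.single i 1)) ≠ 0 := by
    intro h
    apply hf0
    ext y
    simpa using congrFun h y
  obtain ⟨m, hm, hmax⟩ := exists_top_index _ hu0
  let g' : (Fin (d + 1) → F) →ₗ[F] F :=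
    g - (g (Pi.single m 1) / f (Pi.single m 1)) • f
  have hg'm : g' (Pi.single m 1) = 0 := by
    simp [g']; field_simp; simp
  have hg'0 : (fun i => g' (Pi.single i 1)) ≠ 0 := by
    intro h
    apply hgx
    have h1 : g' x = 0 := by
      rw [hrep]
      exact Finset.sum_eq_zero fun i _ => by rw [show g' (Pi.single i 1) = 0 from congrFun h i, mul_zero]
    simpa [g', hfx] using h1
  obtain ⟨n, hn, hnmax⟩ := exists_top_index _ hg'0
  refine diverted_det F d hd φ hφ hφ0 t ht (fun i => f (Pi.single i 1))
    (fun i => g' (Pi.single i 1)) m n ?_ hm hn hmax hnmax ?_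
  · rintro rfl
    exact hn hg'm
  · intro k
    rw [← hrep f (fun i => t k ^ (i : ℕ)), ← hrep f (fun i => φ i * t k ^ ((i : ℕ) - 1)),
      ← hrep g' (fun i => t k ^ (i : ℕ)), ← hrep g' (fun i => φ i * t k ^ ((i : ℕ) - 1))]
    have := hdet k (fun i => t k ^ (i : ℕ)) (fun i => φ i * t k ^ ((i : ℕ) - 1))
      (Submodule.subset_span (by simp)) (Submodule.subset_span (by simp))
    simp only [g', LinearMap.sub_apply, LinearMap.smul_apply, smul_eq_mul]
    linear_combination this

theorem descend_point {F K σ : Type*} [Field F] [IsAlgClosed F] [Field K] [Finite σ]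
    (ψ : F →+* K) (y : σ → K) :
    ∃ x : σ → F, ∀ p : MvPolynomial σ F, MvPolynomial.eval₂ ψ y p = 0 →
      MvPolynomial.eval x p = 0 := by
  have hI : RingHom.ker (MvPolynomial.eval₂Hom ψ y) ≠ ⊤ := RingHom.ker_ne_top _
  obtain ⟨M, hM, hle⟩ := Ideal.exists_le_maximal _ hI
  obtain ⟨x, hx⟩ := MvPolynomial.isMaximal_iff_eq_vanishingIdeal_singleton.1 hM
  refine ⟨x, fun p hp => ?_⟩
  have : p ∈ M := hle (by simpa [RingHom.mem_ker] using hp)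
  rw [hx, MvPolynomial.mem_vanishingIdeal_singleton_iff] at this
  simpa [MvPolynomial.aeval_eq_eval] using this

theorem exists_codim_two (F : Type*) [Field F] [IsAlgClosed F] (e : ℕ) {κ : Type} [Fintype κ]
    (hκ : Fintype.card κ < 2 * e + 1) (a b : κ → Fin (e + 2) → F) :
    ∃ (u v : Fin (e + 2) → F) (i j : Fin (e + 2)), u i = 1 ∧ u j = 0 ∧ v i = 0 ∧ v j = 1 ∧
      ∀ k, (∑ i, a k i * u i) * (∑ i, b k i * v i) -
        (∑ i, b k i * u i) * (∑ i, a k i * v i) = 0 := by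
  classical
  obtain ⟨E, _, _, V, U, W, hF, hf, i', j', hij'⟩ := exists_generic_valuation F e hκ a b
  obtain ⟨⟨i, j⟩, -, hmax⟩ := Finset.exists_max_image
    (Finset.univ : Finset (Fin (e + 2) × Fin (e + 2)))
    (fun q => V.valuation (U q.1 * W q.2 - U q.2 * W q.1)) ⟨(i', j'), Finset.mem_univ _⟩
  set p : E := U i * W j - U j * W i with hp
  have hp1 : 1 < V.valuation p := by
    refine lt_of_lt_of_le ?_ (hmax (i', j') (Finset.mem_univ _))
    rw [← not_le, ValuationSubring.valuation_le_one_iff]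
    exact hij'
  have hp0 : p ≠ 0 := by
    intro h
    rw [h, map_zero] at hp1
    exact absurd hp1 (not_lt.2 zero_le_one)
  have hvp0 : 0 < V.valuation p := lt_trans zero_lt_one hp1
  have hdiv : ∀ k l, (U k * W l - U l * W k) / p ∈ V := by
    intro k l
    rw [← ValuationSubring.valuation_le_one_iff, map_div₀]
    exact (div_le_one₀ hvp0).2 (hmax (k, l) (Finset.mem_univ _))
  let u : Fin (e + 2) → V := fun k => ⟨_, hdiv k j⟩
  let v : Fin (e + 2) → V := fun k => ⟨_, hdiv i k⟩
  let ψ₀ : F →+* V := (algebraMap F E).codRestrict V.toSubring hF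
  let K := IsLocalRing.ResidueField V
  let π : V →+* K := IsLocalRing.residue V
  have hψ : ∀ c, ((ψ₀ c : V) : E) = algebraMap F E c := fun _ => rfl
  have hsu : ∀ c : Fin (e + 2) → F, ((∑ k, ψ₀ (c k) * u k : V) : E) =
      (W j * (∑ k, algebraMap F E (c k) * U k) - U j * ∑ k, algebraMap F E (c k) * W k) / p := by
    intro c
    rw [Finset.mul_sum, Finset.mul_sum, ← Finset.sum_sub_distrib, Finset.sum_div]
    push_cast
    refine Finset.sum_congr rfl fun k _ => ?_
    rw [hψ]
    simp only [u]
    ring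
  have hsv : ∀ c : Fin (e + 2) → F, ((∑ k, ψ₀ (c k) * v k : V) : E) =
      (U i * (∑ k, algebraMap F E (c k) * W k) - W i * ∑ k, algebraMap F E (c k) * U k) / p := by
    intro c
    rw [Finset.mul_sum, Finset.mul_sum, ← Finset.sum_sub_distrib, Finset.sum_div]
    push_cast
    refine Finset.sum_congr rfl fun k _ => ?_
    rw [hψ]
    simp only [v]
    ring
  have hz : ∀ k, (∑ l, ψ₀ (a k l) * u l) * (∑ l, ψ₀ (b k l) * v l) -
      (∑ l, ψ₀ (b k l) * u l) * (∑ l, ψ₀ (a k l) * v l) ∈ IsLocalRing.maximalIdeal V := by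
    intro k
    rw [ValuationSubring.valuation_lt_one_iff]
    have : (((∑ l, ψ₀ (a k l) * u l) * (∑ l, ψ₀ (b k l) * v l) -
      (∑ l, ψ₀ (b k l) * u l) * (∑ l, ψ₀ (a k l) * v l) : V) : E) =
      ((∑ i, algebraMap F E (a k i) * U i) * (∑ i, algebraMap F E (b k i) * W i)
        - (∑ i, algebraMap F E (b k i) * U i) * (∑ i, algebraMap F E (a k i) * W i)) / p := by
      rw [V.toSubring.coe_sub, V.toSubring.coe_mul, V.toSubring.coe_mul, hsu, hsu, hsv, hsv]
      generalize (∑ i, algebraMap F E (a k i) * U i) = x1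
      generalize (∑ i, algebraMap F E (b k i) * U i) = x2
      generalize (∑ i, algebraMap F E (a k i) * W i) = x3
      generalize (∑ i, algebraMap F E (b k i) * W i) = x4
      rw [div_mul_div_comm, div_mul_div_comm, ← sub_div, div_eq_div_iff (mul_ne_zero hp0 hp0) hp0]
      rw [hp]
      ring
    rw [this, map_div₀, div_lt_one₀ hvp0]
    exact lt_of_le_of_lt ((ValuationSubring.valuation_le_one_iff _ _).2 (hf k)) hp1
  obtain ⟨x, hx⟩ := descend_point (π.comp ψ₀) (Sum.elim (fun k => π (u k)) (fun k => π (v k)))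
  have hui : u i = 1 := Subtype.ext (div_self hp0)
  have hvj : v j = 1 := Subtype.ext (div_self hp0)
  have huj : u j = 0 := Subtype.ext (by simp [u])
  have hvi : v i = 0 := Subtype.ext (by simp [v])
  refine ⟨fun k => x (Sum.inl k), fun k => x (Sum.inr k), i, j, ?_, ?_, ?_, ?_, ?_⟩
  · have := hx (MvPolynomial.X (Sum.inl i) - 1) (by simp [hui])
    simpa [sub_eq_zero] using this
  · have := hx (MvPolynomial.X (Sum.inl j)) (by simp [huj])
    simpa using this
  · have := hx (MvPolynomial.X (Sum.inr i)) (by simp [hvi])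
    simpa using this
  · have := hx (MvPolynomial.X (Sum.inr j) - 1) (by simp [hvj])
    simpa [sub_eq_zero] using this
  · intro k
    have h0 := (IsLocalRing.residue_eq_zero_iff _).2 (hz k)
    have := hx ((∑ l, MvPolynomial.C (a k l) * MvPolynomial.X (Sum.inl l)) *
      (∑ l, MvPolynomial.C (b k l) * MvPolynomial.X (Sum.inr l)) -
      (∑ l, MvPolynomial.C (b k l) * MvPolynomial.X (Sum.inl l)) *
      (∑ l, MvPolynomial.C (a k l) * MvPolynomial.X (Sum.inr l))) (by
        rw [← h0]
        simp [π, MvPolynomial.eval₂_sum])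
    simpa using this

theorem generator_card_ge (F : Type*) [Field F] [IsAlgClosed F] (d : ℕ) (hd : 1 ≤ d)
    (L : Finset (Submodule F (Fin (d + 1) → F)))
    (hL : ∀ ℓ ∈ L, Module.finrank F ℓ = 2)
    (hgen : ∀ Pl : Submodule F (Fin (d + 1) → F), Module.finrank F Pl = d →
        Submodule.span F
          (⋃ ℓ ∈ L, ((ℓ : Set (Fin (d + 1) → F)) ∩ (Pl : Set (Fin (d + 1) → F)))) = Pl) :
    2 * d - 1 ≤ L.card := by
  classical
  by_contra! hlt
  obtain ⟨e, rfl⟩ : ∃ e, d = e + 1 := ⟨d - 1, by omega⟩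
  have hb : ∀ ℓ ∈ L, ∃ p q : Fin (e + 2) → F, ℓ = Submodule.span F {p, q} := by
    intro ℓ hℓ
    let B := Module.finBasisOfFinrankEq F ℓ (hL ℓ hℓ)
    refine ⟨B 0, B 1, ?_⟩
    have h1 : Submodule.map ℓ.subtype (Submodule.span F (Set.range B)) = ℓ := by
      rw [B.span_eq, Submodule.map_top, Submodule.range_subtype]
    rw [Submodule.map_span, ← Set.range_comp] at h1
    refine h1.symm.trans ?_
    congr 1
    ext y
    simp [Fin.exists_fin_two, eq_comm]
  choose! p q hpq using hb
  let en := L.equivFin.symm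
  obtain ⟨u, v, i, j, hui, huj, hvi, hvj, hz⟩ := exists_codim_two F e (κ := Fin L.card)
    (by simp; omega) (fun k => p (en k)) (fun k => q (en k))
  let f : (Fin (e + 2) → F) →ₗ[F] F := Fintype.linearCombination F u
  let g : (Fin (e + 2) → F) →ₗ[F] F := Fintype.linearCombination F v
  have hf : ∀ y, f y = ∑ k, y k * u k := fun y => by simp [f, Fintype.linearCombination_apply]
  have hg : ∀ y, g y = ∑ k, y k * v k := fun y => by simp [g, Fintype.linearCombination_apply]
  have hprop : ∀ ℓ ∈ L, ∀ y ∈ ℓ, ∀ z ∈ ℓ, f y * g z = f z * g y := by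
    intro ℓ hℓ y hy z hz'
    have h0 := hz (en.symm ⟨ℓ, hℓ⟩)
    simp only [Equiv.apply_symm_apply, ← hf, ← hg] at h0
    rw [hpq ℓ hℓ, Submodule.mem_span_pair] at hy hz'
    obtain ⟨a, b, rfl⟩ := hy
    obtain ⟨a', b', rfl⟩ := hz'
    simp only [map_add, map_smul, smul_eq_mul]
    linear_combination (a * b' - b * a') * h0
  have hw : ∀ ℓ : Submodule F (Fin (e + 2) → F), ∃ z ∈ ℓ, g z = 0 → ∀ y ∈ ℓ, g y = 0 := by
    intro ℓ
    by_cases h : ∀ y ∈ ℓ, g y = 0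
    · exact ⟨0, zero_mem _, fun _ => h⟩
    · push Not at h
      obtain ⟨z, hz, hgz⟩ := h
      exact ⟨z, hz, fun h => absurd h hgz⟩
  choose w hwmem hw using hw
  have : Infinite F := IsAlgClosed.instInfinite
  obtain ⟨β, hβ⟩ := Infinite.exists_notMem_finset (L.image fun ℓ => - f (w ℓ) / g (w ℓ))
  let h : Module.Dual F (Fin (e + 2) → F) := f + β • g
  let x : Fin (e + 2) → F := Pi.single j 1 - β • Pi.single i 1
  have hfs : ∀ k, f (Pi.single k 1) = u k := fun k => by simp [hf, Pi.single_apply]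
  have hgs : ∀ k, g (Pi.single k 1) = v k := fun k => by simp [hg, Pi.single_apply]
  have hgx : g x = 1 := by simp [x, hgs, hvi, hvj]
  have hhx : h x = 0 := by simp [h, x, hfs, hgs, hui, huj, hvi, hvj]
  have hh0 : h ≠ 0 := by
    intro h0
    have : h (Pi.single i 1) = 1 := by simp [h, hfs, hgs, hui, hvi]
    rw [h0] at this
    simp at this
  have hrank : Module.finrank F (LinearMap.ker h) = e + 1 := by
    have := Module.Dual.finrank_ker_add_one_of_ne_zero (f := h) hh0
    simp at this
    omega
  have hle : LinearMap.ker h ≤ LinearMap.ker g := by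
    rw [← hgen _ hrank, Submodule.span_le]
    refine Set.iUnion₂_subset fun ℓ hℓ y hy => ?_
    obtain ⟨hyℓ, hyh⟩ := hy
    have hyh' : f y + β * g y = 0 := by simpa [h] using hyh
    by_contra hgy
    replace hgy : g y ≠ 0 := hgy
    have hgw : g (w ℓ) ≠ 0 := fun h => hgy (hw ℓ h y hyℓ)
    refine hβ (Finset.mem_image.2 ⟨ℓ, hℓ, ?_⟩)
    rw [div_eq_iff hgw]
    have h1 := hprop ℓ hℓ y hyℓ (w ℓ) (hwmem ℓ)
    apply mul_right_cancel₀ hgy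
    linear_combination h1 - g (w ℓ) * hyh'
  have : g x = 0 := hle (show x ∈ LinearMap.ker h from hhx)
  rw [hgx] at this
  exact one_ne_zero this

/-- Over an algebraically closed field, any `2d - 1` distinct diverted tangent lines form
a generator set with respect to hyperplanes of minimal size: they generate, and every
generator set of lines has at least `2d - 1` elements; so the minimal size of a
higgledy-piggledy line set in `PG(d,F)` is exactly `2d - 1`. -/
theorem diverted_tangents_minimal_generator_algClosed (F : Type*) [Field F]
    [IsAlgClosed F] (d : ℕ) (hd : 1 ≤ d)
    (φ : Fin (d + 1) → F) (hφ : Function.Injective φ)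
    (hφ0 : φ 0 = 0) (hφ1 : φ 1 = 1)
    (t : Fin (2 * d - 1) → F) (ht : Function.Injective t) :
    (∀ Pl : Submodule F (Fin (d + 1) → F), Module.finrank F Pl = d →
      Submodule.span F
        (⋃ k : Fin (2 * d - 1),
          ((divertedTangent F d φ (t k) : Set (Fin (d + 1) → F)) ∩
            (Pl : Set (Fin (d + 1) → F)))) = Pl) ∧
    ∀ L : Finset (Submodule F (Fin (d + 1) → F)),
      (∀ ℓ ∈ L, Module.finrank F ℓ = 2) →
      (∀ Pl : Submodule F (Fin (d + 1) → F), Module.finrank F Pl = d →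
        Submodule.span F
          (⋃ ℓ ∈ L, ((ℓ : Set (Fin (d + 1) → F)) ∩ (Pl : Set (Fin (d + 1) → F)))) = Pl) →
      2 * d - 1 ≤ L.card := by
  exact ⟨fun Pl hPl => diverted_generate F d hd φ hφ hφ0 t ht Pl hPl,
    fun L hL hgen => generator_card_ge F d hd L hL hgen⟩
end
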